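/- In a minimal TDS (X,T), if (x_i, x_{i+1}) belongs to the regionally proximal relation Q(X,T) for each i = 1, …, n−1, then the n-tuple (x_1, …, x_n) belongs to the n-regionally proximal relation Q_n(X,T). -/

import Mathlib

/-- The regionally proximal relation `Q(X,T)`. -/
def RegProx {X : Type*} [MetricSpace X] (T : X → X) (a b : X) : Prop :=
  ∀ ε > (0 : ℝ), ∃ a' b' : X, ∃ m : ℕ,
    dist a a' < ε ∧ dist b b' < ε ∧ dist (T^[m] a') (T^[m] b') < ε

/-- The `n`-regionally proximal relation `Q_n(X,T)`. -/
def RegProxN {X : Type*} [MetricSpace X] (T : X → X) {n : ℕ} (x : Fin n → X) : Prop :=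
  ∀ ε > (0 : ℝ), ∃ x' : Fin n → X, ∃ m : ℕ,
    (∀ i, dist (x i) (x' i) < ε) ∧ ∀ i j, dist (T^[m] (x' i)) (T^[m] (x' j)) < ε

open MeasureTheory Filter Topology Set
open scoped ENNReal

/-- **Krylov–Bogolyubov**: a continuous self-map of a nonempty compact metric space has an
invariant Borel probability measure. -/
theorem exists_measurePreserving_of_continuous {X : Type*} [MetricSpace X] [CompactSpace X]
    [Nonempty X] [MeasurableSpace X] [BorelSpace X] {T : X → X} (hT : Continuous T) :
    ∃ μ : ProbabilityMeasure X, MeasurePreserving T (μ : Measure X) (μ : Measure X) := by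
  obtain ⟨x⟩ := ‹Nonempty X›
  have hprob (N : ℕ) : IsProbabilityMeasure
      (((N + 1 : ℕ) : ℝ≥0∞)⁻¹ • ∑ k ∈ Finset.range (N + 1), Measure.dirac (T^[k] x)) := by
    constructor
    simp only [Measure.smul_apply, Measure.finsetSum_apply, measure_univ, Finset.sum_const,
      Finset.card_range, smul_eq_mul, nsmul_eq_mul, mul_one]
    exact ENNReal.inv_mul_cancel (by simp) (by simp)
  let μs : ℕ → ProbabilityMeasure X := fun N => ⟨_, hprob N⟩
  have hint (f : BoundedContinuousFunction X ℝ) (N : ℕ) :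
      ∫ y, f y ∂(μs N : Measure X) = birkhoffAverage ℝ T f (N + 1) x := by
    change ∫ y, f y ∂(((N + 1 : ℕ) : ℝ≥0∞)⁻¹ •
      ∑ k ∈ Finset.range (N + 1), Measure.dirac (T^[k] x)) = _
    rw [integral_smul_measure, integral_finsetSum_measure (fun i _ => f.integrable _)]
    simp [birkhoffAverage, birkhoffSum, -Nat.cast_add]
  obtain ⟨μ, -, hμ⟩ := isCompact_univ.ultrafilter_le_nhds ((hyperfilter ℕ).map μs) (by simp)
  have hlim : Tendsto μs (hyperfilter ℕ) (𝓝 μ) := hμ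
  rw [ProbabilityMeasure.tendsto_iff_forall_integral_tendsto] at hlim
  refine ⟨μ, hT.measurable, ?_⟩
  have := Measure.isProbabilityMeasure_map (μ := (μ : Measure X)) hT.aemeasurable
  refine ext_of_forall_integral_eq_of_IsFiniteMeasure fun f => ?_
  rw [integral_map hT.aemeasurable f.continuous.aestronglyMeasurable]
  have h₁ := hlim (f.compContinuous ⟨T, hT⟩)
  have h₂ := hlim f
  simp only [hint] at h₁ h₂
  have h₃ : Tendsto (fun N => birkhoffAverage ℝ T f (N + 1) (T x) -
      birkhoffAverage ℝ T f (N + 1) x) (hyperfilter ℕ) (𝓝 0) :=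
    ((tendsto_birkhoffAverage_apply_sub_birkhoffAverage ℝ (f := T) (g := f) (x := x)
      (f.isBounded_range.subset (by rintro _ ⟨n, rfl⟩; exact ⟨_, rfl⟩))).comp
      (tendsto_add_atTop_nat 1)).mono_left Nat.hyperfilter_le_atTop
  have h₄ (N : ℕ) : birkhoffAverage ℝ T (f.compContinuous ⟨T, hT⟩) (N + 1) x =
      birkhoffAverage ℝ T f (N + 1) (T x) := by
    simp [birkhoffAverage, birkhoffSum, ← Function.iterate_succ_apply,
      Function.iterate_succ_apply']
  simp only [h₄] at h₁
  exact sub_eq_zero.1 (tendsto_nhds_unique (h₁.sub h₂) h₃)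

/-- If all forward orbits are dense, an invariant probability measure has full support. -/
theorem isOpenPosMeasure_of_dense_orbits {X : Type*} [TopologicalSpace X] [MeasurableSpace X]
    [BorelSpace X] {T : X → X} (hmin : ∀ x : X, Dense (range fun k : ℕ => T^[k] x))
    {μ : Measure X} [NeZero μ] (hμ : MeasurePreserving T μ μ) : μ.IsOpenPosMeasure := by
  refine ⟨fun U hU hne h0 => NeZero.ne μ (Measure.measure_univ_eq_zero.1 ?_)⟩
  have hcover : (⋃ k : ℕ, T^[k] ⁻¹' U) = univ := by
    refine eq_univ_of_forall fun x => mem_iUnion.2 ?_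
    obtain ⟨_, hy, k, rfl⟩ := (hmin x).inter_open_nonempty U hU hne
    exact ⟨k, hy⟩
  rw [← hcover, measure_iUnion_null_iff]
  intro k
  rw [(hμ.iterate k).measure_preimage hU.measurableSet.nullMeasurableSet, h0]

theorem lowerSemicontinuous_measure_section {Z P : Type*} [TopologicalSpace Z]
    [TopologicalSpace P] [MeasurableSpace Z] (ν : Measure Z) [ν.Regular]
    {V : Set (Z × P)} (hV : IsOpen V) :
    LowerSemicontinuous fun p => ν {z | (z, p) ∈ V} := by
  intro p r hr
  have hopen : IsOpen {z | (z, p) ∈ V} := hV.preimage (Continuous.prodMk_left p)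
  obtain ⟨K, hKV, hK, hrK⟩ := hopen.exists_lt_isCompact hr
  obtain ⟨u, v, -, hv, hKu, hpv, huv⟩ := generalized_tube_lemma hK (isCompact_singleton (x := p))
    hV (by rintro ⟨z, q⟩ ⟨hz, rfl⟩; exact hKV hz)
  filter_upwards [hv.mem_nhds (hpv rfl)] with q hq
  exact hrK.trans_le (measure_mono fun z hz => huv ⟨hKu hz, hq⟩)

/-- A lower semicontinuous function that decreases along the orbits of a minimal system is
constant. -/
theorem LowerSemicontinuous.eq_of_dense_orbits {X α : Type*} [TopologicalSpace X] [CompactSpace X]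
    [LinearOrder α] {T : X → X} (hmin : ∀ x : X, Dense (range fun k : ℕ => T^[k] x))
    {f : X → α} (hf : LowerSemicontinuous f) (hfT : ∀ x, f (T x) ≤ f x) (x y : X) :
    f x = f y := by
  obtain ⟨a, -, ha⟩ := (hf.lowerSemicontinuousOn univ).exists_isMinOn ⟨x, mem_univ x⟩
    isCompact_univ
  have hk (k : ℕ) : f (T^[k] a) ≤ f a := by
    induction k with
    | zero => rfl
    | succ k ih => rw [Function.iterate_succ_apply']; exact (hfT _).trans ih
  have hle (z : X) : f z ≤ f a := by
    have hsub : closure (range fun k : ℕ => T^[k] a) ⊆ f ⁻¹' Iic (f a) :=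
      closure_minimal (by rintro _ ⟨k, rfl⟩; exact hk k) (hf.isClosed_preimage _)
    exact hsub (hmin a z)
  have heq (z : X) : f z = f a := (hle z).antisymm (ha (mem_univ z))
  rw [heq x, heq y]

/-- Sections of a backward invariant open set over a regionally proximal pair agree up to a
null set. -/
theorem RegProx.measure_section_diff_eq_zero {X Z : Type*} [MetricSpace X] [CompactSpace X]
    {T : X → X} (hmin : ∀ x : X, Dense (range fun k : ℕ => T^[k] x))
    [TopologicalSpace Z] [MeasurableSpace Z] [BorelSpace Z] {ν : Measure Z} [ν.Regular]
    [IsFiniteMeasure ν] {S : Z → Z} (hS : MeasurePreserving S ν ν)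
    {O : Set (Z × X)} (hO : IsOpen O) (hinv : ∀ z y, (S z, T y) ∈ O → (z, y) ∈ O)
    {a b : X} (hab : RegProx T a b) :
    ν ({z | (z, b) ∈ O} \ {z | (z, a) ∈ O}) = 0 := by
  have hsec (y : X) : IsOpen {z | (z, y) ∈ O} := hO.preimage (Continuous.prodMk_left y)
  have hconst := (lowerSemicontinuous_measure_section ν hO).eq_of_dense_orbits hmin fun y => by
    rw [← hS.measure_preimage (hsec (T y)).measurableSet.nullMeasurableSet]
    exact measure_mono fun z hz => hinv z y hz
  set c := ν {z | (z, a) ∈ O}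
  have hconst' (y : X) : ν {z | (z, y) ∈ O} = c := hconst y a
  have hO₁ : IsOpen {q : Z × X × X | (q.1, q.2.1) ∈ O} := hO.preimage (by fun_prop)
  have hO₂ : IsOpen {q : Z × X × X | (q.1, q.2.2) ∈ O} := hO.preimage (by fun_prop)
  let h : X × X → ℝ≥0∞ := fun p => ν ({z | (z, p.1) ∈ O} ∩ {z | (z, p.2) ∈ O})
  let u : X × X → ℝ≥0∞ := fun p => ν ({z | (z, p.1) ∈ O} ∪ {z | (z, p.2) ∈ O})
  have hh : LowerSemicontinuous h := lowerSemicontinuous_measure_section ν (hO₁.inter hO₂)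
  have hu : LowerSemicontinuous u := lowerSemicontinuous_measure_section ν (hO₁.union hO₂)
  have hsum (p : X × X) : u p + h p = c + c := by
    change ν (_ ∪ _) + ν (_ ∩ _) = _
    rw [measure_union_add_inter _ (hsec p.2).measurableSet, hconst', hconst']
  have hh_step (y y' : X) : h (T y, T y') ≤ h (y, y') := by
    change ν (_ ∩ _) ≤ ν (_ ∩ _)
    rw [← hS.measure_preimage ((hsec (T y)).inter (hsec (T y'))).measurableSet.nullMeasurableSet]
    exact measure_mono fun z hz => ⟨hinv z y hz.1, hinv z y' hz.2⟩
  have hh_iter (m : ℕ) (y y' : X) : h (T^[m] y, T^[m] y') ≤ h (y, y') := by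
    induction m with
    | zero => rfl
    | succ m ih =>
      rw [Function.iterate_succ_apply', Function.iterate_succ_apply']
      exact (hh_step _ _).trans ih
  have hcfin : c ≠ ∞ := measure_ne_top _ _
  by_contra hne
  have hcu : c < u (a, b) := by
    change c < ν (_ ∪ _)
    rw [← union_sdiff_self, measure_union disjoint_sdiff_right
      ((hsec b).measurableSet.diff (hsec a).measurableSet)]
    exact ENNReal.lt_add_right hcfin hne
  obtain ⟨r, hcr, hru⟩ := exists_between hcu
  have hdiag : {p : X × X | c + c < h p + r} ∈ uniformity X := by
    rw [← nhdsSet_diagonal_eq_uniformity]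
    refine ((hh.add lowerSemicontinuous_const).isOpen_preimage (c + c)).mem_nhdsSet.2 ?_
    rintro ⟨y, y'⟩ hyy'
    obtain rfl : y = y' := hyy'
    change c + c < ν (_ ∩ _) + r
    rw [inter_self, hconst']
    exact (ENNReal.add_lt_add_iff_left hcfin).2 hcr
  obtain ⟨δ, hδ, hδh⟩ := Metric.mem_uniformity_dist.1 hdiag
  obtain ⟨η, hη, hηu⟩ := Metric.eventually_nhds_iff.1 (hu (a, b) r hru)
  obtain ⟨a', b', m, ha', hb', hm⟩ := hab (min δ η) (lt_min hδ hη)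
  have h₁ : c + c < h (T^[m] a', T^[m] b') + r := hδh (hm.trans_le (min_le_left _ _))
  have h₂ : r < u (a', b') := hηu (by
    rw [dist_comm]
    exact max_lt (ha'.trans_le (min_le_right _ _)) (hb'.trans_le (min_le_right _ _)))
  refine lt_irrefl (c + c) (h₁.trans_le ?_)
  rw [← hsum (a', b'), add_comm (u _)]
  gcongr
  exact hh_iter m a' b'

/-- A chain of regionally proximal pairs can be perturbed, keeping its first point fixed, so that
all of its points enter a prescribed open set simultaneously. -/
theorem exists_iterate_mem_of_regProx_chain {X : Type*} [MetricSpace X] [CompactSpace X]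
    {T : X → X} (hT : Continuous T) (hmin : ∀ x : X, Dense (range fun k : ℕ => T^[k] x))
    {U : Set X} (hU : IsOpen U) (hne : U.Nonempty) {δ : ℝ} (hδ : 0 < δ) (n : ℕ)
    (x : Fin (n + 1) → X) (hx : ∀ i : Fin n, RegProx T (x i.castSucc) (x i.succ)) :
    ∃ (x' : Fin (n + 1) → X) (m : ℕ),
      x' 0 = x 0 ∧ (∀ i, dist (x i) (x' i) < δ) ∧ ∀ i, T^[m] (x' i) ∈ U := by
  induction n with
  | zero =>
    obtain ⟨_, hy, k, rfl⟩ := (hmin (x 0)).inter_open_nonempty U hU hne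
    refine ⟨x, k, rfl, fun i => by simpa using hδ, fun i => ?_⟩
    rw [Fin.fin_one_eq_zero i]
    exact hy
  | succ n ih =>
    obtain ⟨w, k, hw0, hwδ, hwU⟩ := ih (fun i => x i.succ) fun i => hx i.succ
    have : Nonempty X := ⟨x 0⟩
    borelize X
    obtain ⟨μ, hμ⟩ := exists_measurePreserving_of_continuous hT
    have := isOpenPosMeasure_of_dense_orbits hmin hμ
    let ν : Measure (Fin (n + 1) → X) := Measure.pi fun _ => (μ : Measure X)
    have hν : MeasurePreserving (fun z i => T (z i)) ν ν := measurePreserving_pi _ _ fun _ => hμ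
    let O : Set ((Fin (n + 1) → X) × X) :=
      ⋃ m : ℕ, {p | T^[m] p.2 ∈ U ∧ ∀ i, T^[m] (p.1 i) ∈ U}
    have hO : IsOpen O := by
      refine isOpen_iUnion fun m => ?_
      have hTm := hT.iterate m
      simp only [ofPred_and, ofPred_forall]
      refine (hU.preimage (by fun_prop)).inter ?_
      exact isOpen_iInter_of_finite fun i => hU.preimage (by fun_prop)
    have hinv (z : Fin (n + 1) → X) (y : X) (h : ((fun i => T (z i)), T y) ∈ O) : (z, y) ∈ O := by
      obtain ⟨m, hm⟩ := mem_iUnion.1 h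
      exact mem_iUnion.2 ⟨m + 1, hm⟩
    have hnull := (hx 0).measure_section_diff_eq_zero hmin hν hO hinv
    let W : Set (Fin (n + 1) → X) := {z | ∀ i, dist (x i.succ) (z i) < δ}
    have hW : IsOpen W := by
      simp only [W, ofPred_forall]
      exact isOpen_iInter_of_finite fun i => isOpen_lt (by fun_prop) continuous_const
    have hB : IsOpen ({z | (z, x (Fin.succ 0)) ∈ O} ∩ W) :=
      (hO.preimage (Continuous.prodMk_left _)).inter hW
    have hBne : ({z | (z, x (Fin.succ 0)) ∈ O} ∩ W).Nonempty := by
      refine ⟨w, mem_iUnion.2 ⟨k, ?_, hwU⟩, hwδ⟩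
      change T^[k] (x (Fin.succ 0)) ∈ U
      rw [← hw0]
      exact hwU 0
    obtain ⟨z, ⟨hzb, hzW⟩, hza⟩ : (({z | (z, x (Fin.succ 0)) ∈ O} ∩ W) ∩
        {z | (z, x 0) ∈ O}).Nonempty := by
      by_contra hempty
      rw [not_nonempty_iff_eq_empty] at hempty
      refine hB.measure_ne_zero ν hBne (measure_mono_null ?_ hnull)
      refine fun z hz => ⟨hz.1, fun hza => ?_⟩
      exact hempty.subset ⟨hz, hza⟩
    obtain ⟨m, hm0, hm⟩ := mem_iUnion.1 hza
    refine ⟨Fin.cons (x 0) z, m, rfl, ?_, ?_⟩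
    · exact Fin.cases (by simpa using hδ) hzW
    · exact Fin.cases hm0 hm

theorem stmt14 {X : Type*} [MetricSpace X] [CompactSpace X]
    (T : X ≃ₜ X)
    (hmin : ∀ x : X, Dense (Set.range fun k : ℕ => (⇑T)^[k] x))
    (n : ℕ) (hn : 2 ≤ n) (x : Fin n → X)
    (hchain : ∀ (i : ℕ) (hi : i + 1 < n),
      RegProx ⇑T (x ⟨i, by omega⟩) (x ⟨i + 1, hi⟩)) :
    RegProxN ⇑T x := by
  intro ε hε
  obtain ⟨n, rfl⟩ : ∃ k, n = k + 1 := ⟨n - 1, by omega⟩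
  obtain ⟨x', m, -, hx', hm⟩ := exists_iterate_mem_of_regProx_chain T.continuous hmin
    (Metric.isOpen_ball (x := x 0)) (Metric.nonempty_ball.2 (half_pos hε)) hε n x
    fun i => hchain i (by omega)
  refine ⟨x', m, hx', fun i j => ?_⟩
  have hi := Metric.mem_ball.1 (hm i)
  have hj := Metric.mem_ball'.1 (hm j)
  linarith [dist_triangle (T^[m] (x' i)) (x 0) (T^[m] (x' j))]
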